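/- Let g : ℝ^d → ℝ^d be continuously differentiable with Lip(g) < 1 and set f(x) = x + g(x). Let p_Z : ℝ^d → (0,∞) be a continuous probability density on ℝ^d with respect to Lebesgue measure, and let μ_X be the pushforward of the measure with density p_Z under the inverse map f⁻¹. Then μ_X has Lebesgue density p_X(x) = p_Z(f(x)) · det(I + Dg(x)), this density is strictly positive, and for every x, log p_X(x) = log p_Z(f(x)) + E_{n,v}[ ∑_{k=1}^{n} ((−1)^{k+1}/k) · (vᵀ (Dg(x))^k v) / P(N ≥ k) ], where v is a standard Gaussian vector in ℝ^d, N is an ℕ-valued random variable independent of v with P(N ≥ k) > 0 for every k ≥ 1, Dg(x) is the Jacobian matrix of g at x, and the random variable inside the expectation is integrable. -/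

import Mathlib

open Matrix MeasureTheory ProbabilityTheory

/-- The Jacobian matrix of `g : ℝ^d → ℝ^d` at `x`: entry `(i, j)` is `∂gᵢ/∂xⱼ (x)`. -/
noncomputable def jacobianMatrix {d : ℕ}
    (g : EuclideanSpace ℝ (Fin d) → EuclideanSpace ℝ (Fin d))
    (x : EuclideanSpace ℝ (Fin d)) : Matrix (Fin d) (Fin d) ℝ :=
  Matrix.of fun i j => fderiv ℝ g x (EuclideanSpace.single j 1) i

/-- Jacobi formula along `s ↦ 1 + s • A`, with `B` in the role of `(1 + t • A)⁻¹ * A`. -/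
theorem hasDerivAt_det_one_add_smul {n : Type*} [Fintype n] [DecidableEq n] {A B : Matrix n n ℝ}
    {t : ℝ}
    (h : (1 + t • A) * B = A) :
    HasDerivAt (fun s : ℝ => (1 + s • A).det) ((1 + t • A).det * B.trace) t := by
  obtain ⟨q, hq⟩ : ∃ q : Polynomial ℝ, ∀ r, (1 + r • B).det = 1 + B.trace * r + q.eval r * r ^ 2 :=
    ⟨_, fun r => Matrix.det_one_add_smul r B⟩
  have heq : (fun s : ℝ => (1 + s • A).det) = fun s =>
      (1 + t • A).det * (1 + B.trace * (s - t) + q.eval (s - t) * (s - t) ^ 2) := by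
    funext s
    rw [← hq, ← Matrix.det_mul]
    congr 1
    rw [mul_add, mul_one, Matrix.mul_smul, h, add_assoc, ← add_smul, add_sub_cancel]
  rw [heq]
  have hs : HasDerivAt (fun s : ℝ => s - t) 1 t := (hasDerivAt_id t).sub_const t
  have hqd : HasDerivAt (fun s : ℝ => q.eval (s - t)) _ t := 
    (q.hasDerivAt (t - t)).comp (h := fun s : ℝ => s - t) t hs
  convert! (((hs.const_mul B.trace).const_add 1).add (hqd.mul (hs.pow 2))).const_mul
    ((1 + t • A).det) using 1
  simp

/-- The Neumann series for `(1 + t • A)⁻¹ * A`. -/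
theorem one_add_smul_mul_tsum_neg_pow_smul {n : Type*} [Fintype n] [DecidableEq n]
    {A : Matrix n n ℝ} {t : ℝ}
    (h : Summable fun k : ℕ => (-t) ^ k • A ^ (k + 1)) :
    (1 + t • A) * ∑' k : ℕ, (-t) ^ k • A ^ (k + 1) = A := by
  have h0 := h.tsum_eq_zero_add
  have h1 : ∑' k : ℕ, (-t) ^ (k + 1) • A ^ (k + 1 + 1)
      = (-t • A) * ∑' k : ℕ, (-t) ^ k • A ^ (k + 1) := by
    rw [← h.tsum_mul_left]
    refine tsum_congr fun k => ?_
    rw [Matrix.smul_mul, Matrix.mul_smul, smul_smul, ← pow_succ', ← pow_succ']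
  rw [h1, pow_zero, one_smul, zero_add, pow_one] at h0
  rw [add_mul, one_mul]
  nth_rewrite 1 [h0]
  simp

/-- `det (1 + A) = exp (tr (log (1 + A)))` when the entries of the powers of `A` decay
geometrically. -/
theorem det_one_add_eq_exp_tsum_trace {n : Type*} [Fintype n] [DecidableEq n] (A : Matrix n n ℝ)
    {L : ℝ}
    (hL0 : 0 ≤ L) (hL : L < 1) (hA : ∀ k i j, |(A ^ k) i j| ≤ L ^ k) :
    (1 + A).det = Real.exp (∑' k : ℕ, (-1) ^ k / (k + 1 : ℝ) * (A ^ (k + 1)).trace) := by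
  set r : ℝ := 2 / (1 + L) with hr
  have hr1 : 1 < r := by rw [hr, lt_div_iff₀ (by linarith)]; linarith
  have hrL : r * L < 1 := by
    rw [hr, div_mul_eq_mul_div, div_lt_one (by linarith)]; linarith
  have hgeo : Summable fun k : ℕ => (r * L) ^ k :=
    summable_geometric_of_lt_one (by positivity) hrL
  have htr : ∀ k, |(A ^ k).trace| ≤ Fintype.card n * L ^ k := fun k => by
    refine (Finset.abs_sum_le_sum_abs _ _).trans ?_
    refine (Finset.sum_le_card_nsmul _ _ (L ^ k) fun i _ => hA k i i).trans ?_
    simp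
  let s : ℕ → ℝ → ℝ := fun k t => (-1) ^ k / (k + 1 : ℝ) * (A ^ (k + 1)).trace * t ^ (k + 1)
  let s' : ℕ → ℝ → ℝ := fun k t => (-t) ^ k * (A ^ (k + 1)).trace
  have hball : ∀ t ∈ Metric.ball (0 : ℝ) r, |t| < r := fun t ht => by simpa using ht
  have hpow : ∀ t ∈ Metric.ball (0 : ℝ) r, ∀ k : ℕ, ∀ a C : ℝ, 0 ≤ C → |a| ≤ C * L ^ (k + 1) →
      |(-t) ^ k * a| ≤ C * L * (r * L) ^ k := fun t ht k a C hC ha => by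
    rw [abs_mul, abs_pow, abs_neg]
    calc |t| ^ k * |a| ≤ r ^ k * (C * L ^ (k + 1)) := by
          gcongr
          exact (hball t ht).le
      _ = C * L * (r * L) ^ k := by rw [mul_pow]; ring
  have hS : ∀ t ∈ Metric.ball (0 : ℝ) r,
      HasDerivAt (fun z => ∑' k, s k z) (∑' k, s' k t) t := fun t ht => by
    refine hasDerivAt_tsum_of_isPreconnected (t := Metric.ball (0 : ℝ) r) (y₀ := 0)
      (hgeo.mul_left (Fintype.card n * L)) Metric.isOpen_ball
      (convex_ball 0 r).isPreconnected (fun k y _ => ?_) (fun k y hy => ?_)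
      (Metric.mem_ball_self (by linarith)) ?_ ht
    · have := ((hasDerivAt_id y).pow (k + 1)).const_mul
        ((-1) ^ k / (k + 1 : ℝ) * (A ^ (k + 1)).trace)
      convert! this using 1
      simp only [s', id, Nat.add_sub_cancel, Nat.cast_add, Nat.cast_one, mul_one]
      rw [neg_pow]
      field_simp
    · exact hpow y hy k _ _ (by positivity) (htr (k + 1))
    · simp [s, summable_zero]
  have hD : ∀ t ∈ Metric.ball (0 : ℝ) r,
      HasDerivAt (fun z : ℝ => (1 + z • A).det) ((1 + t • A).det * ∑' k, s' k t) t :=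
      fun t ht => by
    have hsum : Summable fun k : ℕ => (-t) ^ k • A ^ (k + 1) := by
      refine Pi.summable.2 fun i => Pi.summable.2 fun j => ?_
      refine Summable.of_norm_bounded (hgeo.mul_left (1 * L)) fun k => ?_
      exact hpow t ht k _ 1 zero_le_one (by simpa using hA (k + 1) i j)
    have htrace : (∑' k : ℕ, (-t) ^ k • A ^ (k + 1)).trace = ∑' k, s' k t := by
      have := hsum.map_tsum (Matrix.traceAddMonoidHom n ℝ)
        (by exact continuous_id.matrix_trace)
      simpa [s'] using this
    rw [← htrace]
    exact hasDerivAt_det_one_add_smul (one_add_smul_mul_tsum_neg_pow_smul hsum)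
  have hconst := IsOpen.is_const_of_deriv_eq_zero (𝕜 := ℝ) (s := Metric.ball (0 : ℝ) r)
    (f := fun t => (1 + t • A).det * Real.exp (-∑' k, s k t)) Metric.isOpen_ball
      (convex_ball 0 r).isPreconnected
      (fun t ht => ((hD t ht).mul (hS t ht).neg.exp).differentiableAt.differentiableWithinAt)
      (fun t ht => by
        rw [((hD t ht).fun_mul (hS t ht).fun_neg.exp).deriv, Pi.zero_apply]
        ring)
      (x := 1) (y := 0) (by simpa using hr1) (Metric.mem_ball_self (by linarith))
  simp only [s, one_smul, one_pow, mul_one, zero_smul, add_zero, Matrix.det_one, ne_eq,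
    Nat.succ_ne_zero, not_false_eq_true, zero_pow, mul_zero, tsum_zero, neg_zero,
    Real.exp_zero] at hconst
  rw [Real.exp_neg] at hconst
  exact eq_of_mul_inv_eq_one hconst

/-- The Russian roulette estimator: a series truncated at an independent random index, with each
term
divided by its survival probability, is integrable and has the mean of the full series. -/
theorem russianRoulette_integrable_and_hasSum {Ω E : Type*} [MeasurableSpace Ω] [MeasurableSpace E]
    {P : Measure Ω}
    [IsProbabilityMeasure P] {v : Ω → E} {N : Ω → ℕ} (hN : Measurable N)
    (hindep : IndepFun v N P) (hpos : ∀ k : ℕ, 1 ≤ k → 0 < P {ω | k ≤ N ω})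
    {Y : ℕ → E → ℝ} (hY : ∀ k, Measurable (Y k)) (hYint : ∀ k, Integrable (fun ω => Y k (v ω)) P)
    (hsum : Summable fun k => ∫ ω, ‖Y (k + 1) (v ω)‖ ∂P) :
    Integrable (fun ω => ∑ k ∈ Finset.Icc 1 (N ω), Y k (v ω) / (P {a | k ≤ N a}).toReal) P ∧
    HasSum (fun k => ∫ ω, Y (k + 1) (v ω) ∂P)
      (∫ ω, ∑ k ∈ Finset.Icc 1 (N ω), Y k (v ω) / (P {a | k ≤ N a}).toReal ∂P) := by
  set p : ℕ → ℝ := fun k => (P {a | k ≤ N a}).toReal with hp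
  have hp0 : ∀ k, 1 ≤ k → 0 < p k := fun k hk =>
    ENNReal.toReal_pos (hpos k hk).ne' (measure_ne_top _ _)
  let W : ℕ → ℕ → ℝ := fun k n => (Set.Ici (k + 1)).indicator (fun _ => (p (k + 1))⁻¹) n
  have hWm : ∀ k, Measurable (W k) := fun k => measurable_of_countable _
  have hW0 : ∀ k n, 0 ≤ W k n := fun k n =>
    Set.indicator_nonneg (fun _ _ => (inv_pos.2 (hp0 (k + 1) (by omega))).le) n
  have hWeq : ∀ k, (fun ω => W k (N ω)) =
      {ω | k + 1 ≤ N ω}.indicator (fun _ => (p (k + 1))⁻¹) := fun k => rfl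
  have hset : ∀ k, MeasurableSet {ω | k ≤ N ω} := fun k => hN measurableSet_Ici
  have hWint : ∀ k, Integrable (fun ω => W k (N ω)) P := fun k => by
    rw [hWeq]
    exact (integrable_const _).indicator (hset _)
  have hW1 : ∀ k, ∫ ω, W k (N ω) ∂P = 1 := fun k => by
    rw [hWeq, integral_indicator_const _ (hset _), smul_eq_mul]
    exact mul_inv_cancel₀ (hp0 (k + 1) (by omega)).ne'
  let F : ℕ → Ω → ℝ := fun k ω => Y (k + 1) (v ω) * W k (N ω)
  have hind : ∀ k, IndepFun (fun ω => Y (k + 1) (v ω)) (fun ω => W k (N ω)) P := fun k =>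
    hindep.comp (hY (k + 1)) (hWm k)
  have hFint : ∀ k, Integrable (F k) P := fun k => (hind k).integrable_mul (hYint _) (hWint k)
  have hFI : ∀ k, ∫ ω, F k ω ∂P = ∫ ω, Y (k + 1) (v ω) ∂P := fun k => by
    have := (hind k).integral_fun_mul_eq_mul_integral (hYint _).1 (hWint k).1
    rw [hW1, mul_one] at this
    exact this
  have hFN : ∀ k, ∫ ω, ‖F k ω‖ ∂P = ∫ ω, ‖Y (k + 1) (v ω)‖ ∂P := fun k => by
    have h2 : IndepFun (fun ω => ‖Y (k + 1) (v ω)‖) (fun ω => W k (N ω)) P :=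
      hindep.comp (hY (k + 1)).norm (hWm k)
    have := h2.integral_fun_mul_eq_mul_integral (hYint _).norm.1 (hWint k).1
    rw [hW1, mul_one] at this
    rw [← this]
    refine integral_congr_ae (.of_forall fun ω => ?_)
    simp only [F, norm_mul, Real.norm_of_nonneg (hW0 k _)]
  have hFsum : ∀ ω, HasSum (fun k => F k ω) (∑ k ∈ Finset.Icc 1 (N ω), Y k (v ω) / p k) := by
    intro ω
    have h1 : ∑ k ∈ Finset.Icc 1 (N ω), Y k (v ω) / p k = ∑ k ∈ Finset.range (N ω), F k ω := by
      rw [← Finset.Ico_add_one_right_eq_Icc, Finset.sum_Ico_eq_sum_range]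
      refine Finset.sum_congr (by simp) fun k hk => ?_
      have : k + 1 ≤ N ω := by simpa using hk
      simp [F, W, this, add_comm 1 k, div_eq_mul_inv]
    rw [h1]
    refine hasSum_sum_of_ne_finset_zero fun k hk => ?_
    have : ¬ k + 1 ≤ N ω := by simpa using hk
    simp [F, W, this]
  have hS : Summable fun k => ∫ ω, ‖F k ω‖ ∂P := by simpa only [hFN] using hsum
  have hH := hasSum_integral_of_summable_integral_norm hFint hS
  simp only [fun ω => (hFsum ω).tsum_eq, hFI] at hH
  refine ⟨?_, hH⟩
  have hmeas : AEStronglyMeasurable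
      (fun ω => ∑ k ∈ Finset.Icc 1 (N ω), Y k (v ω) / p k) P :=
    aestronglyMeasurable_of_tendsto_ae Filter.atTop
      (fun n => (Finset.aestronglyMeasurable_fun_sum (Finset.range n) fun k _ => (hFint k).1))
      (.of_forall fun ω => (hFsum ω).tendsto_sum_nat)
  refine ⟨hmeas, ?_⟩
  rw [hasFiniteIntegral_iff_enorm]
  calc ∫⁻ ω, ‖∑ k ∈ Finset.Icc 1 (N ω), Y k (v ω) / p k‖ₑ ∂P
      ≤ ∫⁻ ω, ∑' k, ‖F k ω‖ₑ ∂P := by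
        refine lintegral_mono fun ω => ?_
        rw [← (hFsum ω).tsum_eq]
        exact enorm_tsum_le_tsum_enorm
    _ = ∑' k, ∫⁻ ω, ‖F k ω‖ₑ ∂P := lintegral_tsum fun k => (hFint k).1.enorm
    _ = ∑' k, ENNReal.ofReal (∫ ω, ‖F k ω‖ ∂P) := by
        simp only [ofReal_integral_norm_eq_lintegral_enorm (hFint _)]
    _ < ⊤ := hS.tsum_ofReal_lt_top

theorem integrable_and_integral_eval_mul_eval_pi_gaussianReal {d : ℕ} (i j : Fin d) :
    Integrable (fun x : Fin d → ℝ => x i * x j) (Measure.pi fun _ : Fin d => gaussianReal 0 1) ∧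
    ∫ x : Fin d → ℝ, x i * x j ∂(Measure.pi fun _ : Fin d => gaussianReal 0 1)
      = (1 : Matrix (Fin d) (Fin d) ℝ) i j := by
  have hev := fun i : Fin d => measurePreserving_eval (fun _ : Fin d => gaussianReal 0 1) i
  have hL : ∀ i : Fin d, MemLp (fun x : Fin d → ℝ => x i) 2
      (Measure.pi fun _ : Fin d => gaussianReal 0 1) := fun i =>
    (memLp_id_gaussianReal (μ := 0) (v := 1) 2).comp_measurePreserving (hev i)
  refine ⟨(hL i).integrable_mul (hL j), ?_⟩
  have hm : ∀ i : Fin d, ∫ x : Fin d → ℝ, x i ∂(Measure.pi fun _ : Fin d => gaussianReal 0 1) = 0 :=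
    fun i => by
      have h := integral_id_gaussianReal (μ := 0) (v := 1)
      rw [← (hev i).map_eq,
        integral_map (hev i).aemeasurable (by fun_prop)] at h
      exact h
  by_cases hij : i = j
  · subst hij
    rw [Matrix.one_apply_eq]
    have hvar := variance_fun_id_gaussianReal (μ := 0) (v := 1)
    rw [variance_eq_integral measurable_id'.aemeasurable] at hvar
    simp only [integral_id_gaussianReal, sub_zero] at hvar
    rw [← (hev i).map_eq, integral_map (hev i).aemeasurable (by fun_prop)] at hvar
    simpa [pow_two] using hvar
  · rw [Matrix.one_apply_ne hij]
    have hind := (iIndepFun_pi (X := fun (_ : Fin d) (y : ℝ) => y)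
      (μ := fun _ : Fin d => gaussianReal 0 1) (fun _ => aemeasurable_id)).indepFun hij
    rw [hind.integral_fun_mul_eq_mul_integral (hL i).1 (hL j).1, hm, zero_mul]

theorem integrable_and_integral_mul_of_map_eq_pi_gaussianReal {d : ℕ}
    {Ω : Type*} [MeasurableSpace Ω] {P : Measure Ω} {v : Ω → Fin d → ℝ}
    (hv : Measurable v)
    (hlaw : Measure.map v P = Measure.pi fun _ : Fin d => gaussianReal 0 1) (i j : Fin d) :
    Integrable (fun ω => v ω i * v ω j) P ∧
    ∫ ω, v ω i * v ω j ∂P = (1 : Matrix (Fin d) (Fin d) ℝ) i j := by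
  obtain ⟨h1, h2⟩ := integrable_and_integral_eval_mul_eval_pi_gaussianReal i j
  rw [← hlaw] at h1 h2
  rw [integral_map hv.aemeasurable (by fun_prop)] at h2
  exact ⟨h1.comp_measurable hv, h2⟩

theorem dotProduct_mulVec_eq_sum {n : Type*} [Fintype n] (M : Matrix n n ℝ) (x : n → ℝ) :
    x ⬝ᵥ M.mulVec x = ∑ i, ∑ j, M i j * (x i * x j) := by
  simp only [dotProduct, mulVec, Finset.mul_sum]
  exact Finset.sum_congr rfl fun i _ => Finset.sum_congr rfl fun j _ => by ring

/-- Hutchinson's trace estimator. -/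
theorem hutchinson_integrable_and_integral_eq_trace {d : ℕ} {Ω : Type*} [MeasurableSpace Ω]
    {P : Measure Ω} {v : Ω → Fin d → ℝ}
    (hv : Measurable v)
    (hlaw : Measure.map v P = Measure.pi fun _ : Fin d => gaussianReal 0 1)
    (M : Matrix (Fin d) (Fin d) ℝ) :
    Integrable (fun ω => v ω ⬝ᵥ M.mulVec (v ω)) P ∧
    ∫ ω, v ω ⬝ᵥ M.mulVec (v ω) ∂P = M.trace := by
  have hMint := fun i j => (integrable_and_integral_mul_of_map_eq_pi_gaussianReal hv hlaw i
      j).1.const_mul (M i j)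
  simp only [dotProduct_mulVec_eq_sum]
  refine ⟨integrable_finsetSum _ fun i _ => integrable_finsetSum _ fun j _ => hMint i j, ?_⟩
  rw [integral_finsetSum _ fun i _ => integrable_finsetSum _ fun j _ => hMint i j]
  refine Finset.sum_congr rfl fun i _ => ?_
  rw [integral_finsetSum _ fun j _ => hMint i j]
  simp [integral_const_mul, (integrable_and_integral_mul_of_map_eq_pi_gaussianReal hv hlaw _ _).2,
      Matrix.one_apply]

theorem hutchinson_integral_abs_le {d : ℕ} {Ω : Type*} [MeasurableSpace Ω] {P : Measure Ω}
    {v : Ω → Fin d → ℝ}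
    (hv : Measurable v)
    (hlaw : Measure.map v P = Measure.pi fun _ : Fin d => gaussianReal 0 1)
    {M : Matrix (Fin d) (Fin d) ℝ} {c : ℝ} (hM : ∀ i j, |M i j| ≤ c) :
    ∫ ω, |v ω ⬝ᵥ M.mulVec (v ω)| ∂P ≤ c * ∫ ω, ∑ i, ∑ j, |v ω i * v ω j| ∂P := by
  rw [← integral_const_mul]
  refine integral_mono (hutchinson_integrable_and_integral_eq_trace hv hlaw M).1.abs
      ((integrable_finsetSum _ fun i _ =>
    integrable_finsetSum _ fun j _ => (integrable_and_integral_mul_of_map_eq_pi_gaussianReal hv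
      hlaw i j).1.abs).const_mul c) fun ω => ?_
  simp only [dotProduct_mulVec_eq_sum, Finset.mul_sum]
  refine (Finset.abs_sum_le_sum_abs _ _).trans (Finset.sum_le_sum fun i _ => ?_)
  refine (Finset.abs_sum_le_sum_abs _ _).trans (Finset.sum_le_sum fun j _ => ?_)
  rw [abs_mul]
  exact mul_le_mul_of_nonneg_right (hM i j) (abs_nonneg _)

theorem jacobianMatrix_eq_toMatrix {d : ℕ} (g : EuclideanSpace ℝ (Fin d) → EuclideanSpace ℝ (Fin d))
    (x : EuclideanSpace ℝ (Fin d)) :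
    jacobianMatrix g x = LinearMap.toMatrix (EuclideanSpace.basisFun (Fin d) ℝ).toBasis
      (EuclideanSpace.basisFun (Fin d) ℝ).toBasis (fderiv ℝ g x : _ →ₗ[ℝ] _) := by
  ext i j
  simp [jacobianMatrix, LinearMap.toMatrix_apply]

theorem det_id_add_fderiv {d : ℕ} (g : EuclideanSpace ℝ (Fin d) → EuclideanSpace ℝ (Fin d))
    (x : EuclideanSpace ℝ (Fin d)) :
    (ContinuousLinearMap.id ℝ _ + fderiv ℝ g x).det = (1 + jacobianMatrix g x).det := by
  rw [jacobianMatrix_eq_toMatrix, ContinuousLinearMap.det, ← LinearMap.det_toMatrix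
    (EuclideanSpace.basisFun (Fin d) ℝ).toBasis, ContinuousLinearMap.toLinearMap_add, map_add,
    ContinuousLinearMap.coe_id, LinearMap.toMatrix_id]

/-- The entries of the powers of the Jacobian of an `L`-Lipschitz map decay like the powers of `L`.
-/
theorem abs_jacobianMatrix_pow_apply_le {d : ℕ} {g : EuclideanSpace ℝ (Fin d) → EuclideanSpace ℝ
    (Fin d)} {L : NNReal}
    (hg : LipschitzWith L g) (x : EuclideanSpace ℝ (Fin d)) (k : ℕ) (i j : Fin d) :
    |(jacobianMatrix g x ^ k) i j| ≤ (L : ℝ) ^ k := by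
  have h : (jacobianMatrix g x ^ k) i j = (fderiv ℝ g x ^ k) (EuclideanSpace.single j 1) i := by
    rw [jacobianMatrix_eq_toMatrix, LinearMap.toMatrix_pow, LinearMap.toMatrix_apply]
    simp [← ContinuousLinearMap.toLinearMap_pow]
  rw [h, ← Real.norm_eq_abs]
  have hs : ‖(EuclideanSpace.single j 1 : EuclideanSpace ℝ (Fin d))‖ = 1 := by simp
  have hk : ‖fderiv ℝ g x ^ k‖ ≤ (L : ℝ) ^ k := by
    rcases k.eq_zero_or_pos with rfl | hk
    · simpa using! ContinuousLinearMap.norm_id_le (𝕜 := ℝ) (E := EuclideanSpace ℝ (Fin d))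
    · exact (norm_pow_le' _ hk).trans
        (pow_le_pow_left₀ (norm_nonneg _) (norm_fderiv_le_of_lipschitz ℝ hg) k)
  exact ((PiLp.norm_apply_le _ i).trans (ContinuousLinearMap.le_opNorm _ _)).trans
    (by rw [hs, mul_one]; exact hk)

/-- A contractive perturbation of the identity is a homeomorphism. -/
theorem exists_homeomorph_id_add_of_lipschitzWith {E : Type*} [NormedAddCommGroup E] [NormedSpace ℝ
    E] [CompleteSpace E]
    {g : E → E} {L : NNReal} (hL : L < 1) (hg : LipschitzWith L g) :
    ∃ e : E ≃ₜ E, ⇑e = fun x => x + g x := by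
  have ha : ApproximatesLinearOn (fun x => x + g x)
      ((ContinuousLinearEquiv.refl ℝ E : E ≃L[ℝ] E) : E →L[ℝ] E) Set.univ L := by
    refine LipschitzOnWith.approximatesLinearOn ?_
    convert! hg.lipschitzOnWith (s := Set.univ) using 1
    ext x
    simp
  have hc : Subsingleton E ∨
      L < ‖((ContinuousLinearEquiv.refl ℝ E).symm : E →L[ℝ] E)‖₊⁻¹ := by
    rcases subsingleton_or_nontrivial E with h | h
    · exact .inl h
    · right
      have : ‖((ContinuousLinearEquiv.refl ℝ E).symm : E →L[ℝ] E)‖₊ = 1 :=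
        NNReal.eq ContinuousLinearMap.norm_id
      rw [this, inv_one]
      exact hL
  exact ⟨ha.toHomeomorph _ hc, rfl⟩

/-- Change of variables for the pushforward of a density under the inverse of `e`. -/
theorem map_invFun_withDensity_eq {E : Type*} [NormedAddCommGroup E] [NormedSpace ℝ E]
    [FiniteDimensional ℝ E]
    [MeasurableSpace E] [BorelSpace E] (μ : Measure E) [μ.IsAddHaarMeasure]
    (e : E ≃ₜ E) {e' : E → E →L[ℝ] E} (he : ∀ x, HasFDerivAt e (e' x) x)
    (p : E → ENNReal) :
    (μ.withDensity p).map (Function.invFun e)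
      = μ.withDensity fun x => ENNReal.ofReal |(e' x).det| * p (e x) := by
  have hinv : Function.invFun e = e.symm := by
    funext y
    apply e.injective
    rw [e.apply_symm_apply]
    exact Function.invFun_eq (e.surjective y)
  ext s hs
  rw [hinv, Measure.map_apply e.symm.measurable hs, withDensity_apply _ (e.symm.measurable hs),
    withDensity_apply _ hs, ← e.image_eq_preimage_symm]
  exact lintegral_image_eq_lintegral_abs_det_fderiv_mul μ hs
    (fun x _ => (he x).hasFDerivWithinAt) e.injective.injOn p

/-- Theorem 1 of the paper at the level of densities: let `g` be `C¹` with `Lip(g) < 1`,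
`f(x) = x + g(x)`, and let `p_Z` be a continuous strictly positive probability density on
`ℝ^d`. Then the pushforward under `f⁻¹` of the measure with density `p_Z` has Lebesgue
density `p_X(x) = p_Z(f(x)) · det(I + Dg(x))`, this density is strictly positive, and
for every `x`,
`log p_X(x) = log p_Z(f(x)) + E_{n,v}[∑_{k=1}^n ((-1)^{k+1}/k) (vᵀ Dg(x)^k v)/P(N ≥ k)]`
where `v` is a standard Gaussian vector, `N` is independent of `v` with `P(N ≥ k) > 0`
for all `k ≥ 1`, and the random variable inside the expectation is integrable. -/
theorem residual_flow_unbiased_log_density {d : ℕ}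
    (g : EuclideanSpace ℝ (Fin d) → EuclideanSpace ℝ (Fin d))
    (L : NNReal) (hL : L < 1) (hg : LipschitzWith L g) (hsmooth : ContDiff ℝ 1 g)
    (pZ : EuclideanSpace ℝ (Fin d) → ℝ) (hpZcont : Continuous pZ)
    (hpZpos : ∀ z, 0 < pZ z) (hpZprob : ∫ z, pZ z = 1)
    {Ω : Type*} [MeasurableSpace Ω] (P : Measure Ω) [IsProbabilityMeasure P]
    (v : Ω → Fin d → ℝ) (hvmeas : Measurable v)
    (hvdist : Measure.map v P = Measure.pi fun _ : Fin d => gaussianReal 0 1)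
    (N : Ω → ℕ) (hNmeas : Measurable N) (hindep : IndepFun v N P)
    (hpos : ∀ k : ℕ, 1 ≤ k → 0 < P {ω | k ≤ N ω}) :
    Measure.map (Function.invFun (fun x => x + g x))
        (volume.withDensity fun z => ENNReal.ofReal (pZ z))
      = volume.withDensity
          (fun x => ENNReal.ofReal (pZ (x + g x) * (1 + jacobianMatrix g x).det)) ∧
    (∀ x, 0 < pZ (x + g x) * (1 + jacobianMatrix g x).det) ∧
    ∀ x,
      Integrable
        (fun ω => ∑ k ∈ Finset.Icc 1 (N ω),
          ((-1 : ℝ) ^ (k + 1) / k) * (v ω ⬝ᵥ (jacobianMatrix g x ^ k).mulVec (v ω))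
            / (P {a | k ≤ N a}).toReal) P ∧
      Real.log (pZ (x + g x) * (1 + jacobianMatrix g x).det)
        = Real.log (pZ (x + g x))
          + ∫ ω, (∑ k ∈ Finset.Icc 1 (N ω),
              ((-1 : ℝ) ^ (k + 1) / k) * (v ω ⬝ᵥ (jacobianMatrix g x ^ k).mulVec (v ω))
                / (P {a | k ≤ N a}).toReal) ∂P := by
  have hdet := fun x => det_one_add_eq_exp_tsum_trace (jacobianMatrix g x) L.coe_nonneg
      (by exact_mod_cast hL) (abs_jacobianMatrix_pow_apply_le hg x)
  have hdetpos : ∀ x, 0 < (1 + jacobianMatrix g x).det := fun x => by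
    rw [hdet]
    exact Real.exp_pos _
  refine ⟨?_, fun x => mul_pos (hpZpos _) (hdetpos x), fun x => ?_⟩
  · obtain ⟨e, he⟩ := exists_homeomorph_id_add_of_lipschitzWith hL hg
    have hder : ∀ x, HasFDerivAt e (ContinuousLinearMap.id ℝ _ + fderiv ℝ g x) x := fun x => by
      rw [he]
      exact (hasFDerivAt_id x).add (hsmooth.differentiable one_ne_zero x).hasFDerivAt
    rw [← he, map_invFun_withDensity_eq volume e hder]
    congr 1
    funext x
    rw [det_id_add_fderiv, abs_of_pos (hdetpos x), he, ← ENNReal.ofReal_mul (hdetpos x).le,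
        mul_comm]
  · set J := jacobianMatrix g x with hJ
    let Y : ℕ → (Fin d → ℝ) → ℝ := fun k y => ((-1 : ℝ) ^ (k + 1) / k) * (y ⬝ᵥ (J ^ k).mulVec y)
    have hYm : ∀ k, Measurable (Y k) := fun k => by
      simp only [Y, dotProduct_mulVec_eq_sum]
      fun_prop
    have hYint : ∀ k, Integrable (fun ω => Y k (v ω)) P := fun k =>
      (hutchinson_integrable_and_integral_eq_trace hvmeas hvdist (J ^ k)).1.const_mul _
    have hsum : Summable fun k => ∫ ω, ‖Y (k + 1) (v ω)‖ ∂P := by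
      refine Summable.of_nonneg_of_le (fun k => integral_nonneg fun ω => norm_nonneg _)
        (fun k => ?_) (((summable_geometric_of_lt_one L.coe_nonneg
          (by exact_mod_cast hL)).comp_injective (add_left_injective 1)).mul_right
            (∫ ω, ∑ i, ∑ j, |v ω i * v ω j| ∂P))
      refine (integral_mono (hYint _).norm (hutchinson_integrable_and_integral_eq_trace hvmeas
          hvdist (J ^ (k + 1))).1.abs
        fun ω => ?_).trans (hutchinson_integral_abs_le hvmeas hvdist
          (abs_jacobianMatrix_pow_apply_le hg x (k + 1)))
      simp only [Y, norm_mul, norm_div, norm_pow, norm_neg, norm_one, one_pow, Real.norm_eq_abs]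
      refine mul_le_of_le_one_left (abs_nonneg _) ?_
      rw [abs_of_nonneg (by positivity), Nat.cast_succ]
      exact div_le_one_of_le₀ (by linarith [k.cast_nonneg (α := ℝ)]) (by positivity)
    obtain ⟨h1, h2⟩ := russianRoulette_integrable_and_hasSum hNmeas hindep hpos hYm hYint hsum
    refine ⟨h1, ?_⟩
    rw [Real.log_mul (hpZpos _).ne' (hdetpos x).ne', hdet, Real.log_exp]
    refine congrArg _ (Eq.trans (tsum_congr fun k => ?_) h2.tsum_eq)
    simp only [Y, integral_const_mul, (hutchinson_integrable_and_integral_eq_trace hvmeas hvdist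
        _).2]
    rw [show (-1 : ℝ) ^ (k + 1 + 1) = (-1) ^ k by ring, Nat.cast_succ]
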